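/- Let n = P·q·r be a Carmichael number, where q < r are primes, P > 1, and every prime factor of P is less than q. Then r < P³. -/

import Mathlib

/-- A Carmichael number: a composite positive integer `n` such that
`n ∣ a ^ n - a` for every integer `a`. -/
def IsCarmichael (n : ℕ) : Prop :=
  1 < n ∧ ¬ n.Prime ∧ ∀ a : ℤ, (n : ℤ) ∣ a ^ n - a

/-- If `p` is a prime factor of a Carmichael number `n`, then `p - 1 ∣ n - 1`. -/
theorem IsCarmichael.sub_one_dvd_sub_one {n p : ℕ} (h : IsCarmichael n) (hp : p.Prime)
    (hpn : p ∣ n) : p - 1 ∣ n - 1 := by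
  obtain ⟨hn, -, hdvd⟩ := h
  have : Fact p.Prime := ⟨hp⟩
  obtain ⟨g, hg⟩ := IsCyclic.exists_generator (α := (ZMod p)ˣ)
  have horder : orderOf g = p - 1 := by
    rw [orderOf_eq_card_of_forall_mem_zpowers hg, Nat.card_eq_fintype_card, ZMod.card_units]
  rw [← horder]
  apply orderOf_dvd_of_pow_eq_one
  obtain ⟨a, ha⟩ := ZMod.intCast_surjective (g : ZMod p)
  have hzero : ((a ^ n - a : ℤ) : ZMod p) = 0 :=
    (ZMod.intCast_zmod_eq_zero_iff_dvd _ p).2 ((Int.natCast_dvd_natCast.2 hpn).trans (hdvd a))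
  push_cast at hzero
  rw [ha, sub_eq_zero] at hzero
  have hpow : g ^ n = g := Units.ext (by simpa using hzero)
  refine mul_right_cancel (b := g) ?_
  rw [← pow_succ, Nat.sub_add_cancel hn.le, hpow, one_mul]

/-- If `m * p` is a Carmichael number with `p` prime, then `p - 1 ∣ m - 1`. -/
theorem IsCarmichael.sub_one_dvd_cofactor_sub_one {m p : ℕ} (h : IsCarmichael (m * p))
    (hp : p.Prime) : ((p : ℤ) - 1) ∣ (m : ℤ) - 1 := by
  have hdvd := Int.natCast_dvd_natCast.2 (h.sub_one_dvd_sub_one hp (Dvd.intro_left m rfl))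
  rw [Nat.cast_sub hp.one_le, Nat.cast_sub h.1.le] at hdvd
  push_cast at hdvd
  have hsub : (m : ℤ) - 1 = (m * p - 1) - m * (p - 1) := by ring
  rw [hsub]
  exact dvd_sub hdvd (dvd_mul_left _ _)

/-- If `P * q * r` is a Carmichael number with primes `q < r`, `P > 1`, and every
prime factor of `P` less than `q`, then `r < P³`. -/
theorem r_bound (P q r : ℕ) (hP : 1 < P)
    (hq : q.Prime) (hr : r.Prime) (hqr : q < r)
    (hsmall : ∀ s : ℕ, s.Prime → s ∣ P → s < q)
    (hcarm : IsCarmichael (P * q * r)) :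
    r < P ^ 3 := by
  obtain ⟨C, hC⟩ := hcarm.sub_one_dvd_cofactor_sub_one hr
  obtain ⟨D, hD⟩ :=
    IsCarmichael.sub_one_dvd_cofactor_sub_one (m := P * r) (by rwa [mul_right_comm]) hq
  have hr_ne : r ≠ P * q := by
    rintro rfl
    exact Nat.not_prime_mul hP.ne' hq.ne_one hr
  have hr_ne' : (r : ℤ) ≠ P * q := by exact_mod_cast hr_ne
  have hP' : (2 : ℤ) ≤ P := by exact_mod_cast hP
  have hq' : (2 : ℤ) ≤ q := by exact_mod_cast hq.two_le
  have hr' : (2 : ℤ) ≤ r := by exact_mod_cast hr.two_le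
  push_cast at hC hD
  zify
  generalize (P : ℤ) = P at *
  generalize (q : ℤ) = q at *
  generalize (r : ℤ) = r at *
  have hC_pos : 0 < C := by
    by_contra! hneg
    nlinarith
  have hC_two : 2 ≤ C := by
    by_contra! hlt
    obtain rfl : C = 1 := by omega
    exact hr_ne' (by linarith)
  have hprod : (C * D - P ^ 2) * (q - 1) = (P - 1) * (P + C) := by
    linear_combination (-C) * hD - P * hC
  have hΔ : 1 ≤ C * D - P ^ 2 := by
    by_contra! hlt
    have : 0 < (P - 1) * (P + C) := mul_pos (by linarith) (by linarith)
    nlinarith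
  have hq_le : q - 1 ≤ (P - 1) * (P + C) := by nlinarith
  have hr_le : C * (r - 1) ≤ P * ((P - 1) * (P + C)) + (P - 1) := by nlinarith
  have ht : 2 ≤ P ^ 3 - P ^ 2 + P - 1 := by nlinarith [sq_nonneg P]
  by_contra! hge
  have hlow : C * (P ^ 3 - 1) ≤ C * (r - 1) := by gcongr
  nlinarith
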